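/- Let λ = (λ_1,…,λ_n) be a vector of positive integers that are pairwise relatively prime, and let Λ = ⟨1/λ_1,…,1/λ_n⟩ be the additive submonoid of ℚ_{≥0} generated by 1/λ_1,…,1/λ_n. If Λ is quasinormal, then the ideal I(λ) ⊆ K[x_1,…,x_n] is normal. -/

import Mathlib

/-- `x` is integral over the ideal `I`: there are `m ≥ 1` and `a j ∈ I ^ j` (`j = 1, …, m`)
with `x ^ m + a 1 * x ^ (m - 1) + ⋯ + a m = 0`. -/
def IdealIntegral {R : Type*} [CommRing R] (I : Ideal R) (x : R) : Prop :=
  ∃ m : ℕ, 0 < m ∧ ∃ a : ℕ → R, (∀ j ∈ Finset.Icc 1 m, a j ∈ I ^ j) ∧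
    x ^ m + ∑ j ∈ Finset.Icc 1 m, a j * x ^ (m - j) = 0

/-- A submonoid `Λ` of `ℚ_{≥0}` is quasinormal if whenever `x ∈ Λ` and `x ≥ p` for a
positive integer `p`, then `x = y_1 + ⋯ + y_p` with all `y_j ∈ Λ` and `y_j ≥ 1`. -/
def Quasinormal (Λ : AddSubmonoid ℚ) : Prop :=
  ∀ x ∈ Λ, ∀ p : ℕ, 0 < p → (p : ℚ) ≤ x →
    ∃ y : Fin p → ℚ, (∀ j, y j ∈ Λ) ∧ (∀ j, 1 ≤ y j) ∧ x = ∑ j, y j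

theorem IdealIntegral.of_pow_mem {R : Type*} [CommRing R] {I : Ideal R} {x : R} {m : ℕ}
    (hm : 0 < m) (h : x ^ m ∈ I ^ m) : IdealIntegral I x := by
  refine ⟨m, hm, fun j => if j = m then -x ^ m else 0, fun j _ => ?_, ?_⟩
  · dsimp only
    split_ifs with hj
    · subst hj
      exact neg_mem h
    · exact zero_mem _
  · rw [Finset.sum_eq_single_of_mem m (by simp; omega) (fun j _ hj => by simp [hj])]
    simp

theorem IdealIntegral.map {R S : Type*} [CommRing R] [CommRing S] (φ : R →+* S) {I : Ideal R}
    {I' : Ideal S} (hI : I ≤ I'.comap φ) {x : R} (hx : IdealIntegral I x) :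
    IdealIntegral I' (φ x) := by
  obtain ⟨m, hm, a, ha, h⟩ := hx
  refine ⟨m, hm, fun j => φ (a j), fun j hj => ?_, ?_⟩
  · exact Ideal.mem_comap.mp
      (((Ideal.pow_right_mono hI j).trans (Ideal.le_comap_pow φ j)) (ha j hj))
  · simpa using congrArg φ h

theorem IdealIntegral.dvd_of_span_singleton {R : Type*} [CommRing R] [IsDomain R]
    [IsIntegrallyClosed R] {a y : R} (ha : a ≠ 0) (h : IdealIntegral (Ideal.span {a}) y) :
    a ∣ y := by
  obtain ⟨m, hm, b, hb, h⟩ := h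
  have hb' : ∀ j, ∃ c, j ∈ Finset.Icc 1 m → b j = a ^ j * c := fun j => by
    by_cases hj : j ∈ Finset.Icc 1 m
    · have := hb j hj
      rw [Ideal.span_singleton_pow, Ideal.mem_span_singleton] at this
      obtain ⟨c, hc⟩ := this
      exact ⟨c, fun _ => hc⟩
    · exact ⟨0, fun h => absurd h hj⟩
  choose c hc using hb'
  have ha' : algebraMap R (FractionRing R) a ≠ 0 := by
    simpa using (map_ne_zero_iff _ (IsFractionRing.injective R (FractionRing R))).mpr ha
  have hint : IsIntegral R (algebraMap R (FractionRing R) y / algebraMap R (FractionRing R) a) := by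
    refine ⟨Polynomial.X ^ m + ∑ j ∈ Finset.Icc 1 m,
      Polynomial.C (c j) * Polynomial.X ^ (m - j), ?_, ?_⟩
    · apply Polynomial.monic_X_pow_add
      refine (Polynomial.degree_sum_le _ _).trans_lt ?_
      refine (Finset.sup_lt_iff (WithBot.bot_lt_coe m)).mpr fun j hj => ?_
      rw [Finset.mem_Icc] at hj
      exact (Polynomial.degree_C_mul_X_pow_le _ _).trans_lt (Nat.cast_lt.mpr (by omega))
    · have h2 := congrArg (algebraMap R (FractionRing R)) h
      simp only [map_add, map_pow, map_sum, map_mul, map_zero] at h2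
      simp only [Polynomial.eval₂_add, Polynomial.eval₂_pow, Polynomial.eval₂_X,
        Polynomial.eval₂_finsetSum, Polynomial.eval₂_mul, Polynomial.eval₂_C]
      apply mul_left_cancel₀ (pow_ne_zero m ha')
      rw [mul_zero, ← h2, mul_add, Finset.mul_sum, div_pow, mul_div_cancel₀ _ (pow_ne_zero m ha')]
      congr 1
      refine Finset.sum_congr rfl fun j hj => ?_
      rw [hc j hj]
      rw [Finset.mem_Icc] at hj
      have hmj : algebraMap R (FractionRing R) a ^ m =
          algebraMap R (FractionRing R) a ^ j * algebraMap R (FractionRing R) a ^ (m - j) := by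
        rw [← pow_add]
        congr 1
        omega
      rw [hmj, div_pow, map_mul, map_pow]
      field_simp
  obtain ⟨z, hz⟩ := IsIntegrallyClosed.isIntegral_iff.mp hint
  refine ⟨z, IsFractionRing.injective R (FractionRing R) ?_⟩
  rw [map_mul, hz]
  field_simp

section Grading

variable {σ K : Type*} [CommRing K]

/-- The substitution `x_i ↦ x_i t ^ (w i)`, which records weighted degrees as powers of `t`. -/
noncomputable def weightSubst (w : σ → ℕ) :
    MvPolynomial σ K →ₐ[K] Polynomial (MvPolynomial σ K) :=
  MvPolynomial.aeval fun i => Polynomial.C (MvPolynomial.X i) * Polynomial.X ^ w i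

theorem weightSubst_monomial (w : σ → ℕ) (α : σ →₀ ℕ) (c : K) :
    weightSubst w (MvPolynomial.monomial α c) =
      Polynomial.C (MvPolynomial.monomial α c) * Polynomial.X ^ Finsupp.weight w α := by
  rw [weightSubst, MvPolynomial.aeval_monomial, MvPolynomial.monomial_eq, Finsupp.weight_apply,
    Finsupp.prod, Finsupp.prod, Finsupp.sum, map_mul, map_prod, ← Finset.prod_pow_eq_pow_sum,
    mul_assoc, ← Finset.prod_mul_distrib]
  congr 1
  refine Finset.prod_congr rfl fun i _ => ?_
  rw [mul_pow, ← pow_mul, map_pow, smul_eq_mul, mul_comm (w i)]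

theorem coeff_coeff_weightSubst (w : σ → ℕ) (f : MvPolynomial σ K) (d : ℕ) (α : σ →₀ ℕ) :
    MvPolynomial.coeff α ((weightSubst w f).coeff d) =
      if Finsupp.weight w α = d then MvPolynomial.coeff α f else 0 := by
  classical
  induction f using MvPolynomial.induction_on' with
  | monomial β c =>
    rw [weightSubst_monomial, Polynomial.coeff_C_mul, Polynomial.coeff_X_pow]
    by_cases h : α = β
    · subst h
      by_cases hd : d = Finsupp.weight w α
      · simp [hd]
      · simp [hd, Ne.symm hd]
    · split_ifs <;> simp [MvPolynomial.coeff_monomial, Ne.symm h]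
  | add p q hp hq =>
    rw [map_add, Polynomial.coeff_add, MvPolynomial.coeff_add, hp, hq, MvPolynomial.coeff_add]
    split_ifs <;> simp

theorem X_pow_dvd_weightSubst_iff (w : σ → ℕ) (f : MvPolynomial σ K) (N : ℕ) :
    Polynomial.X ^ N ∣ weightSubst w f ↔ ∀ α ∈ f.support, N ≤ Finsupp.weight w α := by
  rw [Polynomial.X_pow_dvd_iff]
  constructor
  · intro h α hα
    by_contra! hlt
    have := coeff_coeff_weightSubst w f (Finsupp.weight w α) α
    rw [h _ hlt, if_pos rfl, MvPolynomial.coeff_zero] at this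
    exact MvPolynomial.mem_support_iff.mp hα this.symm
  · intro h d hd
    ext α
    rw [coeff_coeff_weightSubst, MvPolynomial.coeff_zero]
    split_ifs with hw
    · by_contra hne
      have := h α (MvPolynomial.mem_support_iff.mpr hne)
      omega
    · rfl

theorem IdealIntegral.le_weight {K : Type*} [Field K] {w : σ → ℕ} {N : ℕ}
    {I : Ideal (MvPolynomial σ K)}
    (hI : I ≤ (Ideal.span {Polynomial.X ^ N}).comap (weightSubst w).toRingHom)
    {f : MvPolynomial σ K} (hf : IdealIntegral I f) : Polynomial.X ^ N ∣ weightSubst w f :=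
  (hf.map _ hI).dvd_of_span_singleton (pow_ne_zero _ Polynomial.X_ne_zero)

end Grading

theorem mem_closure_range_inv_iff {ι : Type*} [Fintype ι] (lam : ι → ℕ) (y : ℚ) :
    y ∈ AddSubmonoid.closure (Set.range fun i => ((lam i : ℚ))⁻¹) ↔
      ∃ β : ι →₀ ℕ, y = ∑ i, β i * (lam i : ℚ)⁻¹ := by
  classical
  constructor
  · intro h
    induction h using AddSubmonoid.closure_induction with
    | mem x hx =>
      obtain ⟨i, rfl⟩ := hx
      refine ⟨Finsupp.single i 1, ?_⟩
      rw [Finset.sum_eq_single_of_mem i (Finset.mem_univ i)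
        (fun j _ hj => by simp [hj.symm])]
      simp
    | zero => exact ⟨0, by simp⟩
    | add x y _ _ hx hy =>
      obtain ⟨β, rfl⟩ := hx
      obtain ⟨γ, rfl⟩ := hy
      exact ⟨β + γ, by simp [add_mul, Finset.sum_add_distrib]⟩
  · rintro ⟨β, rfl⟩
    refine sum_mem fun i _ => ?_
    rw [← nsmul_eq_mul]
    exact nsmul_mem (AddSubmonoid.subset_closure (Set.mem_range_self i)) _

section Coprime

variable {ι : Type*} [Fintype ι] [DecidableEq ι]

/-- The weights `L / λ_i`, where `L` is the product of all the `λ_i`. -/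
def complementaryProd (lam : ι → ℕ) (i : ι) : ℕ := ∏ j ∈ Finset.univ.erase i, lam j

theorem complementaryProd_mul (lam : ι → ℕ) (i : ι) :
    complementaryProd lam i * lam i = ∏ j, lam j :=
  Finset.prod_erase_mul _ _ (Finset.mem_univ i)

theorem weight_complementaryProd (lam : ι → ℕ) (α : ι →₀ ℕ) :
    Finsupp.weight (complementaryProd lam) α = ∑ i, α i * complementaryProd lam i := by
  rw [Finsupp.weight_apply, Finsupp.sum_fintype _ _ (by simp)]
  simp

theorem cast_weight_complementaryProd {lam : ι → ℕ} (hlam : ∀ i, 0 < lam i) (α : ι →₀ ℕ) :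
    (Finsupp.weight (complementaryProd lam) α : ℚ) =
      (∏ j, lam j : ℕ) * ∑ i, α i * (lam i : ℚ)⁻¹ := by
  rw [weight_complementaryProd, Nat.cast_sum, Finset.mul_sum]
  refine Finset.sum_congr rfl fun i _ => ?_
  have : (lam i : ℚ) ≠ 0 := by exact_mod_cast (hlam i).ne'
  rw [← complementaryProd_mul lam i]
  push_cast
  field_simp

theorem modEq_of_weight_eq {lam : ι → ℕ} (hcop : ∀ i j, i ≠ j → Nat.Coprime (lam i) (lam j))
    {α β : ι →₀ ℕ} (h : Finsupp.weight (complementaryProd lam) α =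
      Finsupp.weight (complementaryProd lam) β) (i : ι) : α i ≡ β i [MOD lam i] := by
  have key : ∀ γ : ι →₀ ℕ, Finsupp.weight (complementaryProd lam) γ ≡
      γ i * complementaryProd lam i [MOD lam i] := fun γ => by
    rw [weight_complementaryProd, ← Finset.add_sum_erase _ _ (Finset.mem_univ i)]
    have : lam i ∣ ∑ j ∈ Finset.univ.erase i, γ j * complementaryProd lam j :=
      Finset.dvd_sum fun j hj => Dvd.dvd.mul_left
        (Finset.dvd_prod_of_mem _ (by simp [(Finset.ne_of_mem_erase hj).symm])) _
    exact Nat.ModEq.add_left (γ i * complementaryProd lam i) (Nat.modEq_zero_iff_dvd.mpr this)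
  have hc : Nat.gcd (lam i) (complementaryProd lam i) = 1 :=
    Nat.Coprime.prod_right fun j hj => hcop i j (Finset.ne_of_mem_erase hj).symm
  exact Nat.ModEq.cancel_right_of_coprime hc ((key α).symm.trans
    ((congrArg (· % lam i) h).trans (key β)))

theorem eq_of_weight_eq_of_lt {lam : ι → ℕ} (hlam : ∀ i, 0 < lam i)
    (hcop : ∀ i j, i ≠ j → Nat.Coprime (lam i) (lam j)) {α β : ι →₀ ℕ}
    (h : Finsupp.weight (complementaryProd lam) α = Finsupp.weight (complementaryProd lam) β)
    (hα : ∀ i, α i < lam i) : α = β := by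
  have hle : ∀ i ∈ Finset.univ,
      α i * complementaryProd lam i ≤ β i * complementaryProd lam i := fun i _ => by
    have := modEq_of_weight_eq hcop h i
    rw [Nat.ModEq, Nat.mod_eq_of_lt (hα i)] at this
    exact Nat.mul_le_mul_right _ (this ▸ Nat.mod_le _ _)
  rw [weight_complementaryProd, weight_complementaryProd, Finset.sum_eq_sum_iff_of_le hle] at h
  ext i
  exact Nat.eq_of_mul_eq_mul_right (Finset.prod_pos fun j _ => hlam j) (h i (Finset.mem_univ i))

theorem exists_sum_eq_of_quasinormal {lam : ι → ℕ} (hlam : ∀ i, 0 < lam i)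
    (hcop : ∀ i j, i ≠ j → Nat.Coprime (lam i) (lam j))
    (hqn : Quasinormal (AddSubmonoid.closure (Set.range fun i => ((lam i : ℚ))⁻¹)))
    {p : ℕ} (hp : 0 < p) {α : ι →₀ ℕ} (hα : ∀ i, α i < lam i)
    (hw : p * ∏ j, lam j ≤ Finsupp.weight (complementaryProd lam) α) :
    ∃ β : Fin p → ι →₀ ℕ,
      (∀ j, ∏ i, lam i ≤ Finsupp.weight (complementaryProd lam) (β j)) ∧ α = ∑ j, β j := by
  have hL : (0 : ℚ) < (∏ j, lam j : ℕ) := by exact_mod_cast Finset.prod_pos fun j _ => hlam j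
  obtain ⟨y, hy, hy1, hsum⟩ := hqn (∑ i, α i * (lam i : ℚ)⁻¹)
    ((mem_closure_range_inv_iff lam _).mpr ⟨α, rfl⟩) p hp (by
      have h : ((p * ∏ j, lam j : ℕ) : ℚ) ≤ Finsupp.weight (complementaryProd lam) α := by
        exact_mod_cast hw
      rw [cast_weight_complementaryProd hlam, Nat.cast_mul, mul_comm] at h
      exact le_of_mul_le_mul_left h hL)
  choose β hβ using fun j => (mem_closure_range_inv_iff lam _).mp (hy j)
  refine ⟨β, fun j => ?_, eq_of_weight_eq_of_lt hlam hcop ?_ hα⟩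
  · have : ((∏ i, lam i : ℕ) : ℚ) ≤ Finsupp.weight (complementaryProd lam) (β j) := by
      rw [cast_weight_complementaryProd hlam, ← hβ]
      exact le_mul_of_one_le_right hL.le (hy1 j)
    exact_mod_cast this
  · rw [map_sum, ← Nat.cast_inj (R := ℚ), Nat.cast_sum, cast_weight_complementaryProd hlam, hsum,
      Finset.mul_sum]
    exact Finset.sum_congr rfl fun j _ => by rw [cast_weight_complementaryProd hlam, ← hβ]

theorem monomial_mem_pow_of_quasinormal {K : Type*} [CommRing K] {lam : ι → ℕ}
    (hlam : ∀ i, 0 < lam i) (hcop : ∀ i j, i ≠ j → Nat.Coprime (lam i) (lam j))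
    (hqn : Quasinormal (AddSubmonoid.closure (Set.range fun i => ((lam i : ℚ))⁻¹)))
    {I : Ideal (MvPolynomial ι K)}
    (hI : ∀ β, ∏ i, lam i ≤ Finsupp.weight (complementaryProd lam) β →
      MvPolynomial.monomial β 1 ∈ I) (k : ℕ) (α : ι →₀ ℕ)
    (hw : k * ∏ j, lam j ≤ Finsupp.weight (complementaryProd lam) α) :
    MvPolynomial.monomial α 1 ∈ I ^ k := by
  induction k generalizing α with
  | zero => simp
  | succ k ih =>
    by_cases hα : ∀ i, α i < lam i
    · obtain ⟨β, hβ, rfl⟩ := exists_sum_eq_of_quasinormal hlam hcop hqn k.succ_pos hα hw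
      rw [MvPolynomial.monomial_sum_one, ← Fin.prod_const]
      exact Ideal.prod_mem_prod fun j _ => hI _ (hβ j)
    · push Not at hα
      obtain ⟨i, hi⟩ := hα
      obtain ⟨γ, rfl⟩ := exists_add_of_le (Finsupp.single_le_iff.mpr hi)
      have hs : Finsupp.weight (complementaryProd lam) (Finsupp.single i (lam i)) =
          ∏ j, lam j := by
        rw [Finsupp.weight_single, smul_eq_mul, mul_comm, complementaryProd_mul]
      rw [add_comm, map_add, hs, add_mul, one_mul] at hw
      rw [← one_mul (1 : K), ← MvPolynomial.monomial_mul, pow_succ']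
      exact Ideal.mul_mem_mul (hI _ hs.ge) (ih γ (by omega))

theorem idealIntegral_monomial_of_le_weight {K : Type*} [CommRing K] {lam : ι → ℕ}
    (hlam : ∀ i, 0 < lam i) {α : ι →₀ ℕ}
    (hw : ∏ i, lam i ≤ Finsupp.weight (complementaryProd lam) α) :
    IdealIntegral (Ideal.span (Set.range fun i => (MvPolynomial.X i : MvPolynomial ι K) ^ lam i))
      (MvPolynomial.monomial α 1) := by
  refine .of_pow_mem (Finset.prod_pos fun j _ => hlam j) (Ideal.pow_le_pow_right hw ?_)
  rw [MvPolynomial.monomial_eq, map_one, one_mul, Finsupp.prod_fintype _ _ (by simp),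
    weight_complementaryProd, ← Finset.prod_pow_eq_pow_sum, ← Finset.prod_pow]
  refine Ideal.prod_mem_prod fun i _ => ?_
  rw [← pow_mul, ← complementaryProd_mul lam i, ← mul_assoc, mul_comm _ (lam i),
    pow_mul _ (lam i)]
  refine Ideal.pow_mem_pow ?_ _
  exact Ideal.subset_span (Set.mem_range_self i)

end Coprime

/-- If `λ_1, …, λ_n` are pairwise relatively prime positive integers and
`Λ = ⟨1/λ_1, …, 1/λ_n⟩` is quasinormal, then `I(λ) = \overline{(x_1^{λ_1}, …, x_n^{λ_n})}`
is normal. -/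
theorem I_lambda_normal_of_quasinormal_pairwise_coprime
    {K : Type*} [Field K] {n : ℕ}
    (lam : Fin n → ℕ) (hlam : ∀ i, 0 < lam i)
    -- the `λ_i` are pairwise relatively prime
    (hcop : ∀ i j, i ≠ j → Nat.Coprime (lam i) (lam j))
    (J Ilam : Ideal (MvPolynomial (Fin n) K))
    (hJ : J = Ideal.span (Set.range fun i => (MvPolynomial.X i : MvPolynomial (Fin n) K) ^ lam i))
    -- `I(λ)` is the integral closure of `J(λ)`
    (hIlam : ∀ x : MvPolynomial (Fin n) K, x ∈ Ilam ↔ IdealIntegral J x)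
    (Λ : AddSubmonoid ℚ)
    (hΛ : Λ = AddSubmonoid.closure (Set.range fun i => ((lam i : ℚ))⁻¹))
    (hqn : Quasinormal Λ) :
    ∀ k : ℕ, 0 < k → ∀ x : MvPolynomial (Fin n) K,
      IdealIntegral (Ilam ^ k) x → x ∈ Ilam ^ k := by
  subst hJ hΛ
  have hmono : ∀ β, ∏ i, lam i ≤ Finsupp.weight (complementaryProd lam) β →
      MvPolynomial.monomial β (1 : K) ∈ Ilam := fun β hβ =>
    (hIlam _).mpr (idealIntegral_monomial_of_le_weight hlam hβ)
  have hIle : Ilam ≤ (Ideal.span {Polynomial.X ^ ∏ i, lam i}).comap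
      (weightSubst (K := K) (complementaryProd lam)).toRingHom := fun f hf => by
    refine Ideal.mem_span_singleton.mpr (((hIlam f).mp hf).le_weight ?_)
    rw [Ideal.span_le]
    rintro _ ⟨i, rfl⟩
    refine Ideal.mem_span_singleton.mpr
      (Dvd.intro_left (Polynomial.C (MvPolynomial.X i ^ lam i)) ?_)
    simp [weightSubst, mul_pow, ← pow_mul, complementaryProd_mul]
  intro k _ x hx
  have hdvd : Polynomial.X ^ (k * ∏ i, lam i) ∣ weightSubst (complementaryProd lam) x := by
    refine hx.le_weight ((Ideal.pow_right_mono hIle k).trans ((Ideal.le_comap_pow _ k).trans ?_))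
    rw [Ideal.span_singleton_pow, ← pow_mul, mul_comm]
  rw [X_pow_dvd_weightSubst_iff] at hdvd
  rw [x.as_sum]
  refine sum_mem fun α hα => ?_
  rw [← mul_one (MvPolynomial.coeff α x), ← MvPolynomial.C_mul_monomial]
  exact Ideal.mul_mem_left _ _
    (monomial_mem_pow_of_quasinormal hlam hcop hqn hmono k α (hdvd α hα))
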